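/- (Reverse generalized Minkowski inequality for m summands.) Let n, m ≥ 1, let x_{ij} (1 ≤ i ≤ n, 1 ≤ j ≤ m) be real numbers, let 0 < α ≤ 1, and let 0 < p < 1 be real. Then (∑_{i=1}^n (∑_{j=1}^m |x_{ij}|^α)^p)^(1/p) ≥ ∑_{j=1}^m (∑_{i=1}^n |x_{ij}|^(αp))^(1/p). -/

import Mathlib

/-- Minkowski's inequality for finitely many summands. -/
theorem Real.Lp_sum_le {ι κ : Type*} (s : Finset ι) (t : Finset κ) (f : κ → ι → ℝ) {r : ℝ}
    (hr : 1 ≤ r) :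
    (∑ j ∈ s, |∑ i ∈ t, f i j| ^ r) ^ (1 / r) ≤ ∑ i ∈ t, (∑ j ∈ s, |f i j| ^ r) ^ (1 / r) := by
  have hr0 : r ≠ 0 := by positivity
  simpa using Finset.le_sum_of_subadditive (fun g : ι → ℝ => (∑ j ∈ s, |g j| ^ r) ^ (1 / r))
    (by simp [hr0]) (fun g h => Real.Lp_add_le s g h hr) t f

/-- The reverse Minkowski inequality for exponents in `(0, 1]` and finitely many nonnegative
summands. -/
theorem Real.sum_Lp_le_Lp_sum_of_le_one {ι κ : Type*} (s : Finset ι) (t : Finset κ)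
    (a : κ → ι → ℝ) (ha : ∀ i j, 0 ≤ a i j) {p : ℝ} (hp0 : 0 < p) (hp1 : p ≤ 1) :
    ∑ j ∈ s, (∑ i ∈ t, a i j ^ p) ^ (1 / p) ≤ (∑ i ∈ t, (∑ j ∈ s, a i j) ^ p) ^ (1 / p) := by
  have hb : ∀ i j, 0 ≤ a i j ^ p := fun i j => Real.rpow_nonneg (ha i j) p
  have hS : ∀ j, 0 ≤ ∑ i ∈ t, a i j ^ p := fun j => Finset.sum_nonneg fun i _ => hb i j
  have key := Real.Lp_sum_le s t (fun i j => a i j ^ p) (one_le_one_div hp0 hp1)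
  simp only [abs_of_nonneg (hb _ _), abs_of_nonneg (hS _), one_div_one_div,
    ← Real.rpow_mul (ha _ _), mul_one_div_cancel hp0.ne', Real.rpow_one] at key
  rw [one_div p] at key ⊢
  exact (Real.le_rpow_inv_iff_of_pos
    (Finset.sum_nonneg fun j _ => Real.rpow_nonneg (hS j) _)
    (Finset.sum_nonneg fun i _ => Real.rpow_nonneg (Finset.sum_nonneg fun j _ => ha i j) _)
    hp0).2 key

theorem generalized_reverse_minkowski_m_summands (n m : ℕ) (hn : 1 ≤ n) (hm : 1 ≤ m)
    (x : Fin n → Fin m → ℝ) (α p : ℝ)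
    (hα0 : 0 < α) (hα1 : α ≤ 1) (hp0 : 0 < p) (hp1 : p < 1) :
    (∑ i, (∑ j, |x i j| ^ α) ^ p) ^ (1 / p) ≥
      ∑ j, (∑ i, |x i j| ^ (α * p)) ^ (1 / p) := by
  simp only [Real.rpow_mul (abs_nonneg _)]
  exact Real.sum_Lp_le_Lp_sum_of_le_one _ _ (fun i j => |x i j| ^ α)
    (fun i j => Real.rpow_nonneg (abs_nonneg _) _) hp0 hp1.le
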